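/- A sequence D of non-negative integers is graphic if and only if the iterated Havel–Hakimi reduction applied to D eventually reaches the all-zero (or empty) sequence without ever producing a negative entry or an entry exceeding the number of remaining terms minus one. -/

import Mathlib

/-- A list `D` of integers is *graphic* if there is a simple graph on
`D.length` labeled vertices whose multiset of vertex degrees (viewed in `ℤ`)
equals the multiset of entries of `D`. -/
def IsGraphicZ (D : List ℤ) : Prop :=
  ∃ (G : SimpleGraph (Fin D.length)) (_ : DecidableRel G.Adj),
    (Finset.univ.val.map (fun v => (G.degree v : ℤ)) : Multiset ℤ) = ↑D

/-- One Havel–Hakimi step: sort the sequence non-increasingly, remove the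
first entry `d`, and subtract `1` from each of the next `d` entries. -/
def hhStep (D : List ℤ) : List ℤ :=
  match D.insertionSort (· ≥ ·) with
  | [] => []
  | d :: t => (t.take d.toNat).map (fun x => x - 1) ++ t.drop d.toNat

open Classical in
/-- The degree of a vertex as an integer-valued sum of adjacency indicators. -/
noncomputable def SimpleGraph.degreeSum {V : Type*} [Fintype V] (G : SimpleGraph V) (x : V) : ℤ :=
  ∑ y, if G.Adj x y then 1 else 0

theorem SimpleGraph.degreeSum_eq_sum {V : Type*} [Fintype V] (G : SimpleGraph V)
    [DecidableRel G.Adj] (x : V) : G.degreeSum x = ∑ y, if G.Adj x y then 1 else 0 := by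
  unfold degreeSum
  congr!

theorem SimpleGraph.degreeSum_eq_degree {V : Type*} [Fintype V] (G : SimpleGraph V)
    [DecidableRel G.Adj] (x : V) : G.degreeSum x = G.degree x := by
  rw [degreeSum_eq_sum, Finset.sum_boole, ← G.card_neighborFinset_eq_degree,
    G.neighborFinset_eq_filter]

theorem SimpleGraph.degreeSum_comap_equiv {V W : Type*} [Fintype V] [Fintype W]
    (G : SimpleGraph W) (e : V ≃ W) (x : V) :
    (G.comap e).degreeSum x = G.degreeSum (e x) := by
  classical
  exact Equiv.sum_comp e (fun y => if G.Adj (e x) y then (1 : ℤ) else 0)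

/-- Replacing the edges `ac`, `be` by `ab`, `ce` preserves all degrees. -/
theorem SimpleGraph.exists_switch {V : Type*} [Fintype V] (G : SimpleGraph V) {a b c e : V}
    (hac : G.Adj a c) (hbe : G.Adj b e) (hab : ¬ G.Adj a b) (hce : ¬ G.Adj c e)
    (hne : a ≠ b) (hne' : c ≠ e) :
    ∃ G' : SimpleGraph V, (∀ x, G'.degreeSum x = G.degreeSum x) ∧
      ∀ y, G'.Adj a y ↔ y = b ∨ (G.Adj a y ∧ y ≠ c) := by
  classical
  have hae : a ≠ e := by rintro rfl; exact hab hbe.symm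
  have hbc : b ≠ c := by rintro rfl; exact hab hac
  have hac' := hac.ne
  have hbe' := hbe.ne
  let G' : SimpleGraph V :=
    { Adj := fun x y =>
        (G.Adj x y ∧ ¬ (x = a ∧ y = c ∨ x = c ∧ y = a ∨ x = b ∧ y = e ∨ x = e ∧ y = b)) ∨
          (x = a ∧ y = b ∨ x = b ∧ y = a ∨ x = c ∧ y = e ∨ x = e ∧ y = c)
      symm := ⟨by intro x y h; have := G.adj_comm x y; grind⟩
      loopless := ⟨by intro x h; have := G.irrefl (v := x); grind⟩ }
  refine ⟨G', fun x => ?_, fun y => ?_⟩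
  · have key : ∀ y, (if G'.Adj x y then (1 : ℤ) else 0) = (if G.Adj x y then 1 else 0)
        + (if x = a then (if y = b then 1 else 0) - (if y = c then 1 else 0) else 0)
        + (if x = b then (if y = a then 1 else 0) - (if y = e then 1 else 0) else 0)
        + (if x = c then (if y = e then 1 else 0) - (if y = a then 1 else 0) else 0)
        + (if x = e then (if y = c then 1 else 0) - (if y = b then 1 else 0) else 0) := by
      intro y
      have h1 := hac.symm
      have h2 := hbe.symm
      have h3 : ¬ G.Adj b a := fun h => hab h.symm
      have h4 : ¬ G.Adj e c := fun h => hce h.symm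
      simp only [G']
      by_cases xa : x = a
      · grind
      by_cases xb : x = b
      · grind
      by_cases xc : x = c
      · grind
      by_cases xe : x = e
      · grind
      simp [xa, xb, xc, xe]
    have hz : ∀ (p : Prop) [Decidable p] (u v : V),
        ∑ y, (if p then (if y = u then (1 : ℤ) else 0) - (if y = v then 1 else 0) else 0) = 0 := by
      intro p _ u v
      split_ifs <;> simp
    rw [degreeSum_eq_sum, degreeSum_eq_sum, Finset.sum_congr rfl (fun y _ => key y)]
    simp only [Finset.sum_add_distrib, hz, add_zero]
  · simp only [G']
    grind

/-- If `S` consists of `deg v` vertices other than `v` of largest degree, then some graph with the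
same degrees has `S` as the neighborhood of `v`. -/
theorem SimpleGraph.exists_neighborhood_eq {V : Type*} [Fintype V] (v : V) (S : Finset V)
    (hv : v ∉ S) (G : SimpleGraph V) (hcard : G.degreeSum v = S.card)
    (hmax : ∀ i ∈ S, ∀ j ∉ S, j ≠ v → G.degreeSum j ≤ G.degreeSum i) :
    ∃ G' : SimpleGraph V, (∀ x, G'.degreeSum x = G.degreeSum x) ∧
      ∀ y, G'.Adj v y ↔ y ∈ S := by
  classical
  induction hk : (S.filter (fun y => ¬ G.Adj v y)).card using Nat.strong_induction_on
    generalizing G with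
  | _ k ih =>
  have hN : (Finset.univ.filter (fun y => G.Adj v y)).card = S.card := by
    have h := hcard
    rw [degreeSum_eq_sum, Finset.sum_boole] at h
    exact_mod_cast h
  by_cases hS : S ⊆ Finset.univ.filter (fun y => G.Adj v y)
  · have := Finset.eq_of_subset_of_card_le hS hN.le
    exact ⟨G, fun _ => rfl, fun y => by rw [this]; simp⟩
  have hS' : ¬ Finset.univ.filter (fun y => G.Adj v y) ⊆ S := fun h =>
    hS (Finset.eq_of_subset_of_card_le h hN.ge).ge
  obtain ⟨i, hiS, hi⟩ := Finset.not_subset.1 hS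
  obtain ⟨j, hj, hjS⟩ := Finset.not_subset.1 hS'
  simp only [Finset.mem_filter, Finset.mem_univ, true_and] at hi hj
  have hvi : v ≠ i := by rintro rfl; exact hv hiS
  obtain ⟨w, hwi, hwj, hw⟩ : ∃ w, G.Adj i w ∧ ¬ G.Adj j w ∧ j ≠ w := by
    by_contra! hcon
    have hle := hmax i hiS j hjS hj.ne'
    have hlt : G.degreeSum i < G.degreeSum j := by
      simp only [degreeSum_eq_sum]
      rw [← Equiv.sum_comp (Equiv.swap i j) (fun y => if G.Adj j y then (1 : ℤ) else 0)]
      apply Finset.sum_lt_sum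
      · intro w _
        by_cases h1 : w = i
        · subst h1; simp
        by_cases h2 : w = j
        · subst h2; simp [G.adj_comm]
        rw [Equiv.swap_apply_of_ne_of_ne h1 h2]
        have := hcon w
        grind
      · refine ⟨v, Finset.mem_univ _, ?_⟩
        rw [Equiv.swap_apply_of_ne_of_ne hvi hj.ne]
        simp [hj.symm, G.adj_comm i v, hi]
    omega
  obtain ⟨G', hdeg, hadj⟩ := G.exists_switch hj hwi hi hwj hvi hw
  have hlt : (S.filter (fun y => ¬ G'.Adj v y)).card < k := by
    rw [← hk]
    apply Finset.card_lt_card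
    refine Finset.ssubset_iff_of_subset ?_ |>.2 ⟨i, ?_, ?_⟩
    · intro y
      simp only [Finset.mem_filter, hadj]
      grind
    · simp [hiS, hi]
    · simp [hadj]
  obtain ⟨G'', h1, h2⟩ := ih _ hlt G' (by rw [hdeg, hcard])
    (by simpa only [hdeg] using hmax) rfl
  exact ⟨G'', fun x => (h1 x).trans (hdeg x), h2⟩

theorem exists_perm_comp_eq_of_ofFn_perm {α : Type*} [LinearOrder α] {n : ℕ} {f g : Fin n → α}
    (h : (List.ofFn f).Perm (List.ofFn g)) : ∃ σ : Equiv.Perm (Fin n), f = g ∘ σ := by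
  have hsort : f ∘ Tuple.sort f = g ∘ Tuple.sort g :=
    List.ofFn_injective <| List.Perm.eq_of_sortedLE (Tuple.monotone_sort f).sortedLE_ofFn
      (Tuple.monotone_sort g).sortedLE_ofFn <|
        ((Tuple.sort f).ofFn_comp_perm f).trans <| h.trans ((Tuple.sort g).ofFn_comp_perm g).symm
  refine ⟨(Tuple.sort f).symm.trans (Tuple.sort g), funext fun i => ?_⟩
  simpa using congrFun hsort ((Tuple.sort f).symm i)

theorem isGraphicZ_iff_of_perm {D : List ℤ} {n : ℕ} {f : Fin n → ℤ}
    (h : D.Perm (List.ofFn f)) :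
    IsGraphicZ D ↔ ∃ G : SimpleGraph (Fin n), ∀ i, G.degreeSum i = f i := by
  classical
  obtain rfl : D.length = n := by simpa using h.length_eq
  have hD : (D : Multiset ℤ) = Finset.univ.val.map f := by
    rw [Fin.univ_val_map]
    exact Multiset.coe_eq_coe.2 h
  constructor
  · rintro ⟨G, _, hG⟩
    rw [hD, Fin.univ_val_map, Fin.univ_val_map, Multiset.coe_eq_coe] at hG
    obtain ⟨σ, hσ⟩ := exists_perm_comp_eq_of_ofFn_perm hG
    refine ⟨G.comap σ.symm, fun i => ?_⟩
    rw [SimpleGraph.degreeSum_comap_equiv, SimpleGraph.degreeSum_eq_degree]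
    simpa using congrFun hσ (σ.symm i)
  · rintro ⟨G, hG⟩
    refine ⟨G, Classical.decRel _, ?_⟩
    rw [hD]
    exact congrArg (Multiset.map · _) (funext fun i => by
      rw [← hG i, SimpleGraph.degreeSum_eq_degree])

/-- A degree function on `Fin (m + 1)` in which the vertices `1, …, d` have the largest degrees
among the nonzero vertices is realizable iff its Havel–Hakimi reduction is. -/
theorem exists_degreeSum_iff_reduction {m d : ℕ} (hd : d ≤ m) (f : Fin (m + 1) → ℤ)
    (h0 : f 0 = d) (hf : ∀ i j : Fin m, i ≤ j → f j.succ ≤ f i.succ) :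
    (∃ G : SimpleGraph (Fin (m + 1)), ∀ i, G.degreeSum i = f i) ↔
      ∃ G : SimpleGraph (Fin m), ∀ i, G.degreeSum i = f i.succ - if (i : ℕ) < d then 1 else 0 := by
  classical
  have hcard : (Finset.univ.filter (fun i : Fin m => (i : ℕ) < d)).card = d := by
    rw [Fin.card_filter_val_lt, min_eq_right hd]
  constructor
  · rintro ⟨G, hG⟩
    obtain ⟨G', hdeg, hadj⟩ := G.exists_neighborhood_eq 0
      ((Finset.univ.filter (fun i : Fin m => (i : ℕ) < d)).map (Fin.succEmb m)) (by simp)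
      (by rw [hG, h0, Finset.card_map, hcard])
      (by
        intro i hi j hj hj0
        obtain ⟨j, rfl⟩ := Fin.exists_succ_eq.2 hj0
        simp only [Finset.mem_map, Finset.mem_filter, Finset.mem_univ, true_and,
          Fin.coe_succEmb] at hi hj
        obtain ⟨i, hi, rfl⟩ := hi
        rw [hG, hG]
        apply hf
        by_contra hlt
        exact hj ⟨j, by omega, rfl⟩)
    refine ⟨G'.comap Fin.succ, fun i => ?_⟩
    rw [← hG, ← hdeg]
    simp only [SimpleGraph.degreeSum, Fin.sum_univ_succ, G'.adj_comm i.succ 0, hadj]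
    simp
  · rintro ⟨G, hG⟩
    let G' : SimpleGraph (Fin (m + 1)) :=
      { Adj := fun x y => Fin.cases (Fin.cases False (fun j => (j : ℕ) < d) y)
          (fun i => Fin.cases ((i : ℕ) < d) (fun j => G.Adj i j) y) x
        symm := ⟨by
          intro x y
          cases x using Fin.cases <;> cases y using Fin.cases <;> simp [G.adj_comm]⟩
        loopless := ⟨by intro x; cases x using Fin.cases <;> simp⟩ }
    refine ⟨G', fun i => ?_⟩
    cases i using Fin.cases with
    | zero =>
      have hadj : ∀ j : Fin m, G'.Adj 0 j.succ ↔ (j : ℕ) < d := fun _ => Iff.rfl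
      rw [SimpleGraph.degreeSum_eq_sum, Fin.sum_univ_succ]
      simp only [hadj, G'.irrefl, if_false, Finset.sum_boole, hcard, h0, zero_add]
    | succ i =>
      have hadj0 : G'.Adj i.succ 0 ↔ (i : ℕ) < d := Iff.rfl
      have hadj : ∀ j : Fin m, G'.Adj i.succ j.succ ↔ G.Adj i j := fun _ => Iff.rfl
      have := hG i
      simp only [SimpleGraph.degreeSum_eq_sum, Fin.sum_univ_succ, hadj0, hadj] at this ⊢
      rw [this]
      ring

theorem isGraphicZ_hhStep_iff {D : List ℤ}
    (hD : ∀ d ∈ D, 0 ≤ d ∧ d ≤ (D.length : ℤ) - 1) :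
    IsGraphicZ (hhStep D) ↔ IsGraphicZ D := by
  have hp := D.perm_insertionSort (· ≥ ·)
  have hs := D.pairwise_insertionSort (· ≥ ·)
  unfold hhStep
  cases hsort : D.insertionSort (· ≥ ·) with
  | nil =>
    rw [hsort] at hp
    rw [hp.symm.eq_nil]
  | cons d t =>
    rw [hsort] at hp hs
    have hd := hD d (hp.mem_iff.1 (by simp))
    have hlen := hp.length_eq
    simp only [List.length_cons] at hlen
    obtain ⟨k, rfl⟩ := Int.eq_ofNat_of_zero_le hd.1
    have hk : k ≤ t.length := by omega
    let f : Fin (t.length + 1) → ℤ := ((k : ℤ) :: t).get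
    have hf : D.Perm (List.ofFn f) := by
      rw [show List.ofFn f = (k : ℤ) :: t from List.ofFn_get _]
      exact hp.symm
    rw [isGraphicZ_iff_of_perm hf, exists_degreeSum_iff_reduction hk f rfl]
    · apply isGraphicZ_iff_of_perm
      apply List.Perm.of_eq
      apply List.ext_getElem
      · simp; omega
      · intro i h1 h2
        have hi : i < t.length := by simpa using h2
        simp only [Int.toNat_natCast, List.getElem_append, List.length_map,
          List.length_take, List.getElem_map, List.getElem_take, List.getElem_drop,
          List.getElem_ofFn, f, List.get_eq_getElem, min_eq_left hk]
        split_ifs with hik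
        · rfl
        · simp [Nat.add_sub_cancel' (not_lt.1 hik)]
    · intro i j hij
      have := List.pairwise_iff_getElem.1 (List.pairwise_cons.1 hs).2
      rcases hij.eq_or_lt with rfl | hlt
      · rfl
      · exact this i j i.2 j.2 hlt

theorem IsGraphicZ.mem_bounds {D : List ℤ} (hD : IsGraphicZ D) :
    ∀ d ∈ D, 0 ≤ d ∧ d ≤ (D.length : ℤ) - 1 := by
  obtain ⟨G, _, hG⟩ := hD
  intro d hd
  rw [← Multiset.mem_coe, ← hG, Multiset.mem_map] at hd
  obtain ⟨v, -, rfl⟩ := hd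
  have := G.degree_lt_card_verts v
  rw [Fintype.card_fin] at this
  omega

theorem isGraphicZ_of_forall_eq_zero {D : List ℤ} (hD : ∀ d ∈ D, d = 0) : IsGraphicZ D := by
  rw [isGraphicZ_iff_of_perm (f := D.get) (by rw [List.ofFn_get])]
  exact ⟨⊥, fun i => by rw [hD _ (D.get_mem i)]; simp [SimpleGraph.degreeSum]⟩

theorem length_hhStep (D : List ℤ) : (hhStep D).length = D.length - 1 := by
  have hp := (D.perm_insertionSort (· ≥ ·)).length_eq
  unfold hhStep
  cases hsort : D.insertionSort (· ≥ ·) with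
  | nil => simp [← hp, hsort]
  | cons d t =>
    rw [← hp, hsort]
    simp
    omega

theorem length_iterate_hhStep (D : List ℤ) (k : ℕ) :
    (hhStep^[k] D).length = D.length - k := by
  induction k with
  | zero => rfl
  | succ k ih => rw [Function.iterate_succ_apply', length_hhStep, ih, Nat.sub_sub]

/-- **Correctness of the Havel–Hakimi algorithm.** A sequence `D` of
non-negative integers is graphic iff the iterated Havel–Hakimi reduction
applied to `D` eventually reaches the all-zero (or empty) sequence, without
ever producing a negative entry or an entry exceeding the number of remaining
terms minus one. -/
theorem hh_correct (D : List ℤ) (hnonneg : ∀ d ∈ D, 0 ≤ d) :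
    IsGraphicZ D ↔
      ∃ k : ℕ, (∀ d ∈ hhStep^[k] D, d = 0) ∧
        ∀ j ≤ k, ∀ d ∈ hhStep^[j] D,
          0 ≤ d ∧ d ≤ ((hhStep^[j] D).length : ℤ) - 1 := by
  constructor
  · intro hD
    have hgraphic : ∀ j, IsGraphicZ (hhStep^[j] D) := by
      intro j
      induction j with
      | zero => exact hD
      | succ j ih =>
        rw [Function.iterate_succ_apply']
        exact (isGraphicZ_hhStep_iff ih.mem_bounds).2 ih
    refine ⟨D.length, ?_, fun j _ => (hgraphic j).mem_bounds⟩
    have hnil : hhStep^[D.length] D = [] :=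
      List.length_eq_zero_iff.1 (by rw [length_iterate_hhStep, Nat.sub_self])
    simp [hnil]
  · rintro ⟨k, hzero, hbounds⟩
    refine Nat.decreasingInduction' (P := fun j => IsGraphicZ (hhStep^[j] D))
      (fun j hj _ ih => ?_) k.zero_le (isGraphicZ_of_forall_eq_zero hzero)
    rw [Function.iterate_succ_apply'] at ih
    exact (isGraphicZ_hhStep_iff (hbounds j hj.le)).1 ih
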